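/- arXiv:2308.03066 — 2 statements merged into one kernel-verified Lean document; each statement's English description precedes it below -/
import Mathlib

section
/- Let G be a finite group, let Γ = SC(G, T₁₁, T₂₂, T₁₂, T₂₁) be a quasi-abelian semi-Cayley digraph with adjacency matrix A (viewed over ℂ), and let χ be an irreducible complex character of G of degree d = χ(1). If λ ∈ ℂ satisfies d²·λ² − d·(χ(T₁₁) + χ(T₂₂))·λ + (χ(T₁₁)·χ(T₂₂) − χ(T₁₂)·χ(T₂₁)) = 0, then λ is a root of the characteristic polynomial of A, i.e. λ is an eigenvalue of A. -/
/-- A finset of elements of a group is conjugation-closed if its image under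
conjugation by any group element equals itself. -/
def ConjClosedF {G : Type*} [Group G] [DecidableEq G] (T : Finset G) : Prop :=
  ∀ g : G, T.image (fun x => g⁻¹ * x * g) = T

/-- The adjacency matrix (over ℂ) of the semi-Cayley digraph
`SC(G, T₁₁, T₂₂, T₁₂, T₂₁)`, with the two copies of `G` given by the two summands of
`G ⊕ G`. -/
def scMatrix {G : Type*} [Group G] [DecidableEq G] (T11 T22 T12 T21 : Finset G) :
    Matrix (G ⊕ G) (G ⊕ G) ℂ :=
  fun x y =>
    match x, y with
    | Sum.inl h, Sum.inl g => if g * h⁻¹ ∈ T11 then 1 else 0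
    | Sum.inr h, Sum.inr g => if g * h⁻¹ ∈ T22 then 1 else 0
    | Sum.inl h, Sum.inr g => if g * h⁻¹ ∈ T12 then 1 else 0
    | Sum.inr h, Sum.inl g => if g * h⁻¹ ∈ T21 then 1 else 0

/-- `χ : G → ℂ` is an irreducible complex character of `G` if it is the trace function of
a nonzero irreducible finite-dimensional complex representation of `G`. -/
def IsIrrChar (G : Type*) [Group G] (χ : G → ℂ) : Prop :=
  ∃ (V : Type) (_ : AddCommGroup V) (_ : Module ℂ V) (_ : FiniteDimensional ℂ V)
    (_ : Nontrivial V) (ρ : Representation ℂ G V),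
    (∀ W : Submodule ℂ V, (∀ g : G, ∀ v ∈ W, ρ g v ∈ W) → W = ⊥ ∨ W = ⊤) ∧
    ∀ g : G, χ g = LinearMap.trace ℂ V (ρ g)

/-- Schur's lemma for class sums: a conjugation-closed set acts on an irreducible representation
by a scalar, which the character determines. -/
lemma IsIrrChar.mul_sum_mul_right {G : Type*} [Group G] [DecidableEq G] {χ : G → ℂ}
    (hχ : IsIrrChar G χ) {T : Finset G} (hT : ConjClosedF T) (h : G) :
    χ 1 * ∑ s ∈ T, χ (s * h) = (∑ s ∈ T, χ s) * χ h := by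
  obtain ⟨V, _, _, _, _, ρ, hirr, htr⟩ := hχ
  have hcomm : ∀ g : G, ρ g * ∑ s ∈ T, ρ s = (∑ s ∈ T, ρ s) * ρ g := by
    intro g
    conv_lhs => rw [← hT g]
    rw [Finset.sum_image (by intro x _ y _ hxy; simpa using hxy), Finset.mul_sum,
      Finset.sum_mul]
    refine Finset.sum_congr rfl fun s _ => ?_
    rw [← map_mul, ← map_mul]
    congr 1
    group
  obtain ⟨c, hc⟩ := Module.End.exists_eigenvalue (∑ s ∈ T, ρ s)
  have htop : Module.End.eigenspace (∑ s ∈ T, ρ s) c = ⊤ := by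
    refine (hirr _ fun g v hv => ?_).resolve_left hc
    rw [Module.End.mem_eigenspace_iff] at hv ⊢
    rw [← Module.End.mul_apply, ← hcomm, Module.End.mul_apply, hv, map_smul]
  have hscalar : ∑ s ∈ T, ρ s = c • (1 : Module.End ℂ V) := by
    ext v
    exact Module.End.mem_eigenspace_iff.mp (htop ▸ Submodule.mem_top)
  have hsum : ∀ k : G, ∑ s ∈ T, χ (s * k) = c * χ k := by
    intro k
    simp_rw [htr, map_mul]
    rw [← map_sum, ← Finset.sum_mul, hscalar, smul_mul_assoc, one_mul, map_smul, smul_eq_mul]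
  have hone := hsum 1
  simp only [mul_one] at hone
  rw [hsum, hone]
  ring

/-- An irreducible character does not vanish at the identity. -/
lemma IsIrrChar.apply_one_ne_zero {G : Type*} [Group G] {χ : G → ℂ} (hχ : IsIrrChar G χ) :
    χ 1 ≠ 0 := by
  obtain ⟨V, _, _, _, _, ρ, -, htr⟩ := hχ
  rw [htr, map_one, LinearMap.trace_one]
  exact_mod_cast Module.finrank_pos.ne'

/-- Summing over the out-neighbours of `h` in a Cayley digraph with connection set `T`. -/
lemma sum_ite_mul_inv_mem {G R : Type*} [Group G] [Fintype G] [DecidableEq G] [NonAssocSemiring R]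
    (T : Finset G) (f : G → R) (h : G) :
    ∑ g, (if g * h⁻¹ ∈ T then 1 else 0) * f g = ∑ s ∈ T, f (s * h) := by
  rw [← Equiv.sum_comp (Equiv.mulRight h)]
  simp

theorem stmt_4 {G : Type*} [Group G] [Fintype G] [DecidableEq G]
    (T11 T22 T12 T21 : Finset G)
    (h11 : ConjClosedF T11) (h22 : ConjClosedF T22)
    (h12 : ConjClosedF T12) (h21 : ConjClosedF T21)
    (χ : G → ℂ) (hχ : IsIrrChar G χ)
    (lam : ℂ)
    (hquad : (χ 1) ^ 2 * lam ^ 2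
        - χ 1 * ((∑ s ∈ T11, χ s) + (∑ s ∈ T22, χ s)) * lam
        + ((∑ s ∈ T11, χ s) * (∑ s ∈ T22, χ s)
            - (∑ s ∈ T12, χ s) * (∑ s ∈ T21, χ s)) = 0) :
    (scMatrix T11 T22 T12 T21).charpoly.IsRoot lam := by
  have hd := hχ.apply_one_ne_zero
  obtain ⟨v, hv, hNv⟩ := Matrix.exists_mulVec_eq_zero_iff.mpr
    (show (!![χ 1 * lam - ∑ s ∈ T11, χ s, -∑ s ∈ T12, χ s;
      -∑ s ∈ T21, χ s, χ 1 * lam - ∑ s ∈ T22, χ s]).det = 0 by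
        rw [Matrix.det_fin_two_of]; linear_combination hquad)
  have hrow1 := congrFun hNv 0
  have hrow2 := congrFun hNv 1
  simp only [Matrix.mulVec, dotProduct, Fin.sum_univ_two, Matrix.of_apply, Matrix.cons_val,
    Pi.zero_apply] at hrow1 hrow2
  rw [Polynomial.IsRoot.def, Matrix.eval_charpoly]
  refine Matrix.exists_mulVec_eq_zero_iff.mp
    ⟨Sum.elim (fun g => v 0 * χ g) (fun g => v 1 * χ g), fun h0 => hv ?_, ?_⟩
  · have h1 := congrFun h0 (Sum.inl 1)
    have h2 := congrFun h0 (Sum.inr 1)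
    simp only [Sum.elim_inl, Sum.elim_inr, Pi.zero_apply, mul_eq_zero, hd, or_false] at h1 h2
    ext i
    fin_cases i
    · exact h1
    · exact h2
  · rw [Matrix.sub_mulVec, sub_eq_zero, Matrix.scalar_apply]
    ext x
    rw [Matrix.mulVec_diagonal]
    refine mul_left_cancel₀ hd ?_
    rcases x with h | h <;>
      simp only [Matrix.mulVec, dotProduct, Fintype.sum_sum_type,
        scMatrix, Sum.elim_inl, Sum.elim_inr, sum_ite_mul_inv_mem, ← Finset.mul_sum]
    · linear_combination χ h * hrow1 - v 0 * hχ.mul_sum_mul_right h11 h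
        - v 1 * hχ.mul_sum_mul_right h12 h
    · linear_combination χ h * hrow2 - v 0 * hχ.mul_sum_mul_right h21 h
        - v 1 * hχ.mul_sum_mul_right h22 h
end

section
/- Let G be a finite group of exponent m, let Γ = SC(G, T₁₁, T₂₂, T₁₂, T₂₁) be a quasi-abelian semi-Cayley digraph, and set I₂ = (T₁₁T₁₁) ⊎ (T₂₂T₂₂) ⊎ 4*(T₁₂T₂₁) and I₃ = 2*(T₁₁T₂₂). Let ζ ∈ ℂ be a primitive m-th root of unity, let t be an integer coprime to m, and let σ_t be the automorphism of ℚ(ζ) over ℚ with σ_t(ζ) = ζ^t. Then σ_t(χ(I₂ \ I₃) − χ(I₃ \ I₂)) = χ(I₂ \ I₃) − χ(I₃ \ I₂) for every irreducible complex character χ of G if and only if (I₂ \ I₃)^t = I₂ \ I₃ and (I₃ \ I₂)^t = I₃ \ I₂ (as multisets), where X^t = [x^t : x ∈ X]. -/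
open IntermediateField

/-- The multiset of pairwise products `[x·y : x ∈ X, y ∈ Y]` of two multisets of a group. -/
def msProd {G : Type*} [Group G] (X Y : Multiset G) : Multiset G :=
  X.bind (fun x => Y.map (fun y => x * y))

open Module in
/-- The power sums of the eigenvalues of an endomorphism of finite order compute the traces of
its powers. -/
lemma exists_trace_pow_eq_sum {V : Type*} [AddCommGroup V] [Module ℂ V] [FiniteDimensional ℂ V]
    {T : End ℂ V} {m : ℕ} (hm : m ≠ 0) (hT : T ^ m = 1) :
    ∃ (s : Finset ℂ) (d : ℂ → ℕ), (∀ μ ∈ s, μ ^ m = 1) ∧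
      ∀ k : ℕ, LinearMap.trace ℂ V (T ^ k) = ∑ μ ∈ s, d μ * μ ^ k := by
  have hss : T.IsSemisimple := by
    refine End.isSemisimple_of_squarefree_aeval_eq_zero
      (p := (Polynomial.X ^ m - 1 : Polynomial ℂ)) ?_ (by simp [hT])
    exact (Polynomial.separable_X_pow_sub_C (1 : ℂ) (by exact_mod_cast hm) one_ne_zero).squarefree
  have hint : DirectSum.IsInternal (fun μ : ℂ => T.eigenspace μ) :=
    DirectSum.isInternal_submodule_of_iSupIndep_of_iSup_eq_top T.eigenspaces_iSupIndep
      hss.iSup_eigenspace_eq_top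
  have hfin : {μ : ℂ | T.eigenspace μ ≠ ⊥}.Finite :=
    WellFoundedGT.finite_ne_bot_of_iSupIndep T.eigenspaces_iSupIndep
  have hpow : ∀ (k : ℕ) (μ : ℂ) (v : V), v ∈ T.eigenspace μ → (T ^ k) v = μ ^ k • v := by
    intro k μ v hv
    rw [End.mem_eigenspace_iff] at hv
    induction k with
    | zero => simp
    | succ k ih => rw [pow_succ', Module.End.mul_apply, ih, map_smul, hv, smul_smul, pow_succ]
  refine ⟨hfin.toFinset, fun μ => finrank ℂ (T.eigenspace μ), fun μ hμ => ?_, fun k => ?_⟩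
  · rw [Set.Finite.mem_toFinset] at hμ
    obtain ⟨v, hv, hv0⟩ := (Submodule.ne_bot_iff _).1 hμ
    have h := hpow m μ v hv
    rw [hT, Module.End.one_apply] at h
    have h' : (μ ^ m - 1) • v = 0 := by rw [sub_smul, one_smul, ← h, sub_self]
    exact sub_eq_zero.1 ((smul_eq_zero.1 h').resolve_right hv0)
  · have hmaps : ∀ μ : ℂ, Set.MapsTo (T ^ k) (T.eigenspace μ) (T.eigenspace μ) := by
      intro μ v hv
      rw [SetLike.mem_coe, hpow k μ v hv]
      exact Submodule.smul_mem _ _ hv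
    rw [LinearMap.trace_eq_sum_trace_restrict' hint hfin hmaps]
    refine Finset.sum_congr rfl fun μ _ => ?_
    have hres : (T ^ k).restrict (hmaps μ) = μ ^ k • LinearMap.id := by
      ext v
      exact hpow k μ v v.2
    rw [hres, map_smul, LinearMap.trace_id, smul_eq_mul, mul_comm]

/-- An automorphism of `ℚ(ζ)` raising `ζ` to the `n`-th power maps the character value at `g`
to the character value at `g ^ n`. -/
lemma IsIrrChar.exists_galois_apply {G : Type*} [Group G] [Finite G] {χ : G → ℂ}
    (hχ : IsIrrChar G χ) {ζ : ℂ} (hζ : IsPrimitiveRoot ζ (Monoid.exponent G)) {n : ℕ}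
    (σ : ℚ⟮ζ⟯ ≃ₐ[ℚ] ℚ⟮ζ⟯)
    (hσ : (σ ⟨ζ, IntermediateField.mem_adjoin_simple_self ℚ ζ⟩ : ℂ) = ζ ^ n) (g : G) :
    ∃ y : ℚ⟮ζ⟯, (y : ℂ) = χ g ∧ (σ y : ℂ) = χ (g ^ n) := by
  obtain ⟨V, _, _, _, _, ρ, -, htr⟩ := hχ
  have hm : Monoid.exponent G ≠ 0 := Monoid.exponent_ne_zero_of_finite
  obtain ⟨s, d, hs, hd⟩ := exists_trace_pow_eq_sum (T := ρ g) hm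
    (by rw [← map_pow, Monoid.pow_exponent_eq_one, map_one])
  have : NeZero (Monoid.exponent G) := ⟨hm⟩
  have hex : ∀ μ ∈ s, ∃ i : ℕ, ζ ^ i = μ := fun μ hμ =>
    (hζ.eq_pow_of_pow_eq_one (hs μ hμ)).imp fun _ h => h.2
  choose! i hi using hex
  set z : ℚ⟮ζ⟯ := ⟨ζ, IntermediateField.mem_adjoin_simple_self ℚ ζ⟩
  have hz : (z : ℂ) = ζ := rfl
  refine ⟨∑ μ ∈ s, (d μ : ℚ⟮ζ⟯) * z ^ i μ, ?_, ?_⟩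
  · have h1 := hd 1
    rw [pow_one] at h1
    rw [htr, h1]
    push_cast
    refine Finset.sum_congr rfl fun μ hμ => ?_
    rw [hz, hi μ hμ, pow_one]
  · rw [htr, map_pow, hd n]
    simp only [map_sum, map_mul, map_pow, map_natCast]
    push_cast
    refine Finset.sum_congr rfl fun μ hμ => ?_
    rw [hσ, pow_right_comm, hi μ hμ]

lemma isIrrChar_trace {G : Type*} [Group G] {V : Type*} [AddCommGroup V] [Module ℂ V]
    [FiniteDimensional ℂ V] [Nontrivial V] (ρ : Representation ℂ G V)
    (hρ : ∀ W : Submodule ℂ V, (∀ g : G, ∀ v ∈ W, ρ g v ∈ W) → W = ⊥ ∨ W = ⊤) :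
    IsIrrChar G (fun g => LinearMap.trace ℂ V (ρ g)) := by
  let e : V ≃ₗ[ℂ] (Fin (Module.finrank ℂ V) → ℂ) := (Module.finBasis ℂ V).equivFun
  let ρ' : Representation ℂ G (Fin (Module.finrank ℂ V) → ℂ) :=
    { toFun := fun g => e.conj (ρ g)
      map_one' := by rw [map_one]; exact e.conj_id
      map_mul' := fun g h => by rw [map_mul]; exact e.conj_comp _ _ }
  refine ⟨_, inferInstance, inferInstance, inferInstance, e.symm.toEquiv.nontrivial, ρ', ?_,
    fun g => (LinearMap.trace_conj' (ρ g) e).symm⟩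
  intro W hW
  have hcomap := hρ (W.comap e.toLinearMap) fun g v hv => by
    have := hW g (e v) hv
    simpa [ρ', LinearEquiv.conj_apply] using this
  have hW' : W = (W.comap e.toLinearMap).map e.toLinearMap :=
    (Submodule.map_comap_eq_of_surjective e.surjective W).symm
  rcases hcomap with h | h
  · left; rw [hW', h, Submodule.map_bot]
  · right; rw [hW', h, Submodule.map_top, LinearEquiv.range]

/-- On a simple module, a central element of the group algebra acts by zero as soon as its trace
is zero. -/
lemma smul_eq_zero_of_central_of_trace_eq_zero {A V : Type*} [Ring A] [Algebra ℂ A]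
    [AddCommGroup V] [Module ℂ V] [Module A V] [IsScalarTower ℂ A V] [IsSimpleModule A V]
    [FiniteDimensional ℂ V] {z : A} (hz : ∀ a, z * a = a * z)
    (htr : LinearMap.trace ℂ V (Algebra.lsmul ℂ ℂ V z) = 0) (v : V) : z • v = 0 := by
  let T : Module.End A V :=
    { toFun := fun v => z • v
      map_add' := smul_add z
      map_smul' := fun a v => by simp [smul_smul, hz a] }
  obtain ⟨c, hc⟩ :=
    (IsSimpleModule.algebraMap_end_bijective_of_isAlgClosed (A := A) (V := V) ℂ).2 T
  have hcv : ∀ v : V, z • v = c • v := fun v => (congr($hc v)).symm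
  have hlin : Algebra.lsmul ℂ ℂ V z = c • LinearMap.id := LinearMap.ext hcv
  have : Nontrivial V := IsSimpleModule.nontrivial A V
  rw [hlin, map_smul, LinearMap.trace_id, smul_eq_mul, mul_eq_zero] at htr
  have hc0 : c = 0 := htr.resolve_right (by exact_mod_cast Module.finrank_pos.ne')
  rw [hcv, hc0, zero_smul]

/-- A class function orthogonal to all irreducible characters vanishes. -/
lemma eq_zero_of_forall_isIrrChar_sum_eq_zero {G : Type*} [Group G] [Fintype G] {f : G → ℂ}
    (hf : ∀ g x : G, f (g⁻¹ * x * g) = f x)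
    (h : ∀ χ : G → ℂ, IsIrrChar G χ → ∑ g, f g * χ g = 0) : f = 0 := by
  let z : MonoidAlgebra ℂ G := ∑ g, f g • MonoidAlgebra.of ℂ G g
  have hof : ∀ g : G, z * MonoidAlgebra.of ℂ G g = MonoidAlgebra.of ℂ G g * z := by
    intro g
    simp only [z, Finset.sum_mul, Finset.mul_sum, smul_mul_assoc, mul_smul_comm, ← map_mul]
    refine Fintype.sum_equiv (MulAut.conj g⁻¹).toEquiv _ _ fun x => ?_
    have hx : (MulAut.conj g⁻¹).toEquiv x = g⁻¹ * x * g := by simp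
    rw [hx, hf, mul_assoc, mul_inv_cancel_left]
  have hz : ∀ a, z * a = a * z := by
    intro a
    induction a using MonoidAlgebra.induction_on with
    | of g => exact hof g
    | add a b ha hb => rw [mul_add, add_mul, ha, hb]
    | smul c a ha => rw [mul_smul_comm, smul_mul_assoc, ha]
  have hann : ∀ S : Submodule (MonoidAlgebra ℂ G) (MonoidAlgebra ℂ G),
      IsSimpleModule (MonoidAlgebra ℂ G) S → ∀ v : S, z • v = 0 := by
    intro S hS
    have : FiniteDimensional ℂ S :=
      inferInstanceAs (FiniteDimensional ℂ (S.restrictScalars ℂ))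
    have : Nontrivial S := IsSimpleModule.nontrivial (MonoidAlgebra ℂ G) S
    refine smul_eq_zero_of_central_of_trace_eq_zero (V := S) hz ?_
    have hirr := isIrrChar_trace
      ((Algebra.lsmul ℂ ℂ S : MonoidAlgebra ℂ G →ₐ[ℂ] _).toMonoidHom.comp (MonoidAlgebra.of ℂ G))
      (by
        intro W hW
        let W' : Submodule (MonoidAlgebra ℂ G) S :=
          { W with
            smul_mem' := fun a v hv => by
              induction a using MonoidAlgebra.induction_on with
              | of g => exact hW g v hv
              | add a b ha hb => rw [add_smul]; exact W.add_mem ha hb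
              | smul c a ha => rw [smul_assoc]; exact W.smul_mem c ha }
        have hmem : ∀ v, v ∈ W' ↔ v ∈ W := fun v => Iff.rfl
        refine (eq_bot_or_eq_top W').imp (fun h => ?_) (fun h => ?_) <;>
        · ext v
          rw [← hmem, h]
          simp)
    have h0 := h _ hirr
    simp only [z, map_sum, map_smul, smul_eq_mul]
    exact h0
  have htop : (⊤ : Submodule (MonoidAlgebra ℂ G) (MonoidAlgebra ℂ G)) ≤
      LinearMap.ker (LinearMap.toSpanSingleton (MonoidAlgebra ℂ G) (MonoidAlgebra ℂ G) z) := by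
    rw [← IsSemisimpleModule.sSup_simples_eq_top, sSup_le_iff]
    intro S hS v hv
    have := congrArg Subtype.val (hann S hS ⟨v, hv⟩)
    rw [LinearMap.mem_ker, LinearMap.toSpanSingleton_apply, smul_eq_mul, ← hz]
    exact this
  have hz0 : z = 0 := by simpa using htop (Submodule.mem_top (x := 1))
  funext x
  have hx := congrArg (fun a : MonoidAlgebra ℂ G => a.coeff x) hz0
  classical
  simpa [z, MonoidAlgebra.of_apply, Finsupp.single_apply] using hx

lemma map_conj_msProd {G : Type*} [Group G] [DecidableEq G] {S T : Finset G}
    (hS : ConjClosedF S) (hT : ConjClosedF T) (g : G) :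
    (msProd S.val T.val).map (fun x => g⁻¹ * x * g) = msProd S.val T.val := by
  have hinj : Function.Injective fun x : G => g⁻¹ * x * g := fun a b h => by simpa using h
  have hval : ∀ U : Finset G, ConjClosedF U → U.val.map (fun x => g⁻¹ * x * g) = U.val := by
    intro U hU
    rw [← Finset.image_val_of_injOn hinj.injOn, hU g]
  conv_rhs => rw [← hval S hS, ← hval T hT]
  simp only [msProd, Multiset.map_bind, Multiset.bind_map, Multiset.map_map, Function.comp_def]
  refine Multiset.bind_congr fun x _ => Multiset.map_congr rfl fun y _ => ?_
  group

lemma sum_map_eq_sum_count_mul {G : Type*} [Fintype G] [DecidableEq G] (X : Multiset G)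
    (χ : G → ℂ) : (X.map χ).sum = ∑ g, (X.count g : ℂ) * χ g := by
  rw [Finset.sum_multiset_map_count]
  simp only [nsmul_eq_mul]
  refine Finset.sum_subset (Finset.subset_univ _) fun g _ hg => ?_
  rw [Multiset.mem_toFinset] at hg
  simp [Multiset.count_eq_zero_of_notMem hg]

lemma map_eq_self_iff_count {G : Type*} [Finite G] [DecidableEq G] {e : G → G}
    (he : Function.Injective e) (X : Multiset G) :
    X.map e = X ↔ ∀ g, X.count (e g) = X.count g := by
  have hcount : ∀ g, (X.map e).count (e g) = X.count g := fun g =>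
    Multiset.count_map_eq_count' e X he g
  refine ⟨fun h g => by rw [← hcount g, h], fun h => Multiset.ext.2 fun x => ?_⟩
  obtain ⟨g, rfl⟩ := Finite.surjective_of_injective he x
  rw [hcount, h]

theorem stmt_8 {G : Type*} [Group G] [Fintype G] [DecidableEq G]
    (T11 T22 T12 T21 : Finset G)
    (h11 : ConjClosedF T11) (h22 : ConjClosedF T22)
    (h12 : ConjClosedF T12) (h21 : ConjClosedF T21)
    (I2 I3 : Multiset G)
    (hI2 : I2 = msProd T11.val T11.val + msProd T22.val T22.val + 4 • msProd T12.val T21.val)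
    (hI3 : I3 = 2 • msProd T11.val T22.val)
    (ζ : ℂ) (hζ : IsPrimitiveRoot ζ (Monoid.exponent G))
    (t : ℤ) (ht : Int.gcd t (Monoid.exponent G) = 1)
    (σ : ℚ⟮ζ⟯ ≃ₐ[ℚ] ℚ⟮ζ⟯)
    (hσ : (σ ⟨ζ, IntermediateField.mem_adjoin_simple_self ℚ ζ⟩ : ℂ) = ζ ^ t)
    (hmem : ∀ χ : G → ℂ, IsIrrChar G χ →
      ((I2 - I3).map χ).sum - ((I3 - I2).map χ).sum ∈ ℚ⟮ζ⟯) :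
    (∀ χ : G → ℂ, ∀ hχ : IsIrrChar G χ,
        ((σ ⟨((I2 - I3).map χ).sum - ((I3 - I2).map χ).sum, hmem χ hχ⟩ : ℚ⟮ζ⟯) : ℂ)
          = ((I2 - I3).map χ).sum - ((I3 - I2).map χ).sum)
      ↔ ((I2 - I3).map (fun x => x ^ t) = I2 - I3
          ∧ (I3 - I2).map (fun x => x ^ t) = I3 - I2) := by
  classical
  have hm : (Monoid.exponent G : ℤ) ≠ 0 := by exact_mod_cast Monoid.exponent_ne_zero_of_finite
  obtain ⟨n, hn⟩ := Int.eq_ofNat_of_zero_le (Int.emod_nonneg t hm)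
  have htn : t = Monoid.exponent G * (t / Monoid.exponent G) + n := by
    rw [← hn, Int.mul_ediv_add_emod]
  have hgpow : ∀ g : G, g ^ t = g ^ n := by
    intro g
    rw [htn, zpow_add, zpow_mul, zpow_natCast, Monoid.pow_exponent_eq_one, one_zpow, one_mul,
      zpow_natCast]
  have hζ0 : ζ ≠ 0 := hζ.ne_zero Monoid.exponent_ne_zero_of_finite
  have hζpow : ζ ^ t = ζ ^ n := by
    rw [htn, zpow_add₀ hζ0, zpow_mul, zpow_natCast, hζ.pow_eq_one, one_zpow, one_mul,
      zpow_natCast]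
  rw [hζpow] at hσ
  have hinj : Function.Injective fun x : G => x ^ t := by
    have hinv : ∀ x : G, (x ^ t) ^ Int.gcdA t (Monoid.exponent G) = x := by
      intro x
      have hb := Int.gcd_eq_gcd_ab t (Monoid.exponent G)
      rw [ht] at hb
      have hx : x ^ ((Monoid.exponent G : ℤ) * Int.gcdB t (Monoid.exponent G)) = 1 := by
        rw [zpow_mul, zpow_natCast, Monoid.pow_exponent_eq_one, one_zpow]
      rw [← zpow_mul, ← mul_one (x ^ _), ← hx, ← zpow_add, ← hb]
      simp
    exact Function.LeftInverse.injective (g := fun x => x ^ Int.gcdA t (Monoid.exponent G)) hinv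
  let e : G ≃ G := Equiv.ofBijective _ (Finite.injective_iff_bijective.1 hinj)
  have he : ∀ g, e g = g ^ n := hgpow
  let f : G → ℂ := fun g => (I2.count g : ℂ) - I3.count g
  have hsum : ∀ χ : G → ℂ,
      ((I2 - I3).map χ).sum - ((I3 - I2).map χ).sum = ∑ g, f g * χ g := by
    intro χ
    rw [sum_map_eq_sum_count_mul, sum_map_eq_sum_count_mul, ← Finset.sum_sub_distrib]
    refine Finset.sum_congr rfl fun g _ => ?_
    rw [← sub_mul, Multiset.count_sub, Multiset.count_sub]
    congr 1
    have : ((I2.count g - I3.count g : ℕ) : ℤ) - ((I3.count g - I2.count g : ℕ) : ℤ)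
        = I2.count g - I3.count g := by omega
    have := congrArg (Int.cast : ℤ → ℂ) this
    rwa [Int.cast_sub, Int.cast_sub, Int.cast_natCast, Int.cast_natCast, Int.cast_natCast,
      Int.cast_natCast] at this
  have hσsum : ∀ χ : G → ℂ, ∀ hχ : IsIrrChar G χ,
      ((σ ⟨((I2 - I3).map χ).sum - ((I3 - I2).map χ).sum, hmem χ hχ⟩ : ℚ⟮ζ⟯) : ℂ)
        = ∑ g, f (e.symm g) * χ g := by
    intro χ hχ
    choose y hy hσy using hχ.exists_galois_apply hζ σ hσ
    have hval : (⟨((I2 - I3).map χ).sum - ((I3 - I2).map χ).sum, hmem χ hχ⟩ : ℚ⟮ζ⟯)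
        = ∑ g, ((I2.count g : ℚ⟮ζ⟯) - I3.count g) * y g := by
      apply Subtype.ext
      refine (hsum χ).trans ?_
      push_cast
      exact Finset.sum_congr rfl fun g _ => by rw [hy]
    rw [hval]
    simp only [map_sum, map_mul, map_sub, map_natCast]
    push_cast
    refine Fintype.sum_equiv e _ _ fun g => ?_
    rw [hσy, e.symm_apply_apply, he]
  have hconj : ∀ g x : G, f (g⁻¹ * x * g) = f x := by
    intro g x
    have hi : Function.Injective fun x : G => g⁻¹ * x * g := fun a b h => by simpa using h
    have h2 : I2.map (fun x => g⁻¹ * x * g) = I2 := by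
      rw [hI2, Multiset.map_add, Multiset.map_add, Multiset.map_nsmul, map_conj_msProd h11 h11,
        map_conj_msProd h22 h22, map_conj_msProd h12 h21]
    have h3 : I3.map (fun x => g⁻¹ * x * g) = I3 := by
      rw [hI3, Multiset.map_nsmul, map_conj_msProd h11 h22]
    simp only [f]
    rw [(map_eq_self_iff_count hi I2).1 h2 x, (map_eq_self_iff_count hi I3).1 h3 x]
  have hesymm : ∀ g x : G, e.symm (g⁻¹ * x * g) = g⁻¹ * e.symm x * g := by
    intro g x
    rw [Equiv.symm_apply_eq, he]
    have := conj_pow (i := n) (a := g⁻¹) (b := e.symm x)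
    rw [inv_inv] at this
    rw [this, ← he, e.apply_symm_apply]
  have hchar : (∀ χ : G → ℂ, IsIrrChar G χ → ∑ g, f (e.symm g) * χ g = ∑ g, f g * χ g)
      ↔ ∀ g, f (e g) = f g := by
    constructor
    · intro h g
      have h0 := eq_zero_of_forall_isIrrChar_sum_eq_zero (f := fun g => f (e.symm g) - f g)
        (fun g x => by rw [hesymm, hconj, hconj])
        (fun χ hχ => by simp only [sub_mul, Finset.sum_sub_distrib, h χ hχ, sub_self])
      have := congrFun h0 (e g)
      simp only [e.symm_apply_apply, Pi.zero_apply] at this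
      exact (sub_eq_zero.1 this).symm
    · intro h χ _
      refine Finset.sum_congr rfl fun g _ => ?_
      rw [← h (e.symm g), e.apply_symm_apply]
  have hcount : (∀ g, f (e g) = f g) ↔ ((I2 - I3).map (fun x => x ^ t) = I2 - I3
      ∧ (I3 - I2).map (fun x => x ^ t) = I3 - I2) := by
    rw [map_eq_self_iff_count hinj, map_eq_self_iff_count hinj, ← forall_and]
    refine forall_congr' fun g => ?_
    have hcast : f (e g) = f g ↔ (I2.count (g ^ t) : ℤ) - I3.count (g ^ t)
        = I2.count g - I3.count g := by
      rw [← Int.cast_inj (α := ℂ)]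
      push_cast
      exact Iff.rfl
    rw [hcast]
    simp only [Multiset.count_sub]
    omega
  rw [← hcount, ← hchar]
  refine forall_congr' fun χ => forall_congr' fun hχ => ?_
  rw [hσsum χ hχ, hsum χ]
end
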